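/- arXiv:1804.08695 — 4 statements merged into one kernel-verified Lean document; each statement's English description precedes it below -/
import Mathlib

section
/- Let sl(2,ℝ) denote the Lie algebra of traceless 2×2 real matrices, and let M be a finite-dimensional Lie module over sl(2,ℝ). For every v ∈ M, the stabilizer subalgebra {X ∈ sl(2,ℝ) : X ⬝ v = 0} does not have dimension exactly 2 (its dimension is 0, 1 or 3). -/
open LieAlgebra.SpecialLinear in
/-- The traceless matrix with entries `a, b, c, -a`. -/
def slMk (a b c : ℝ) : sl (Fin 2) ℝ :=
  ⟨!![a, b; c, -a], by
    change _ ∈ LinearMap.ker (Matrix.traceLinearMap (Fin 2) ℝ ℝ)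
    simp [Matrix.trace_fin_two]⟩

open LieAlgebra.SpecialLinear in
theorem slMk_surj (X : sl (Fin 2) ℝ) : ∃ a b c, X = slMk a b c := by
  obtain ⟨X, hX⟩ := X
  have h : X ∈ LinearMap.ker (Matrix.traceLinearMap (Fin 2) ℝ ℝ) := hX
  simp [Matrix.trace_fin_two] at h
  refine ⟨X 0 0, X 0 1, X 1 0, Subtype.ext ?_⟩
  ext i j
  fin_cases i <;> fin_cases j <;> simp [slMk]
  linarith

theorem slMk_eq_iff {a b c a' b' c' : ℝ} :
    slMk a b c = slMk a' b' c' ↔ a = a' ∧ b = b' ∧ c = c' := by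
  constructor
  · intro h
    have h' := congrArg Subtype.val h
    refine ⟨?_, ?_, ?_⟩
    · simpa [slMk] using congrFun (congrFun h' 0) 0
    · simpa [slMk] using congrFun (congrFun h' 0) 1
    · simpa [slMk] using congrFun (congrFun h' 1) 0
  · rintro ⟨rfl, rfl, rfl⟩; rfl

theorem slMk_add (a b c a' b' c' : ℝ) :
    slMk a b c + slMk a' b' c' = slMk (a + a') (b + b') (c + c') := by
  apply Subtype.ext
  ext i j
  fin_cases i <;> fin_cases j <;> simp [slMk]
  ring

theorem slMk_smul (t a b c : ℝ) : t • slMk a b c = slMk (t * a) (t * b) (t * c) := by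
  apply Subtype.ext
  ext i j
  fin_cases i <;> fin_cases j <;> simp [slMk]

theorem slMk_lie (a b c a' b' c' : ℝ) :
    ⁅slMk a b c, slMk a' b' c'⁆ =
      slMk (b * c' - b' * c) (2 * (a * b' - a' * b)) (2 * (c * a' - c' * a)) := by
  apply Subtype.ext
  change (slMk a b c).1 * (slMk a' b' c').1 - (slMk a' b' c').1 * (slMk a b c).1 = _
  ext i j
  fin_cases i <;> fin_cases j <;> simp [slMk, Matrix.mul_apply, Fin.sum_univ_two] <;> ring

theorem slMk_zero : slMk 0 0 0 = 0 := by
  have := slMk_smul 0 0 0 0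
  simpa using this.symm

open LieAlgebra.SpecialLinear in
/-- coordinates -/
noncomputable def slEquiv : (Fin 3 → ℝ) ≃ₗ[ℝ] sl (Fin 2) ℝ :=
  LinearEquiv.ofBijective
    { toFun := fun x => slMk (x 0) (x 1) (x 2)
      map_add' := fun x y => by simp [slMk_add]
      map_smul' := fun t x => by simp [slMk_smul] }
    ⟨fun x y h => by
      obtain ⟨h0, h1, h2⟩ := slMk_eq_iff.1 h
      ext i; fin_cases i <;> assumption,
     fun X => by
      obtain ⟨a, b, c, rfl⟩ := slMk_surj X
      exact ⟨![a, b, c], by simp⟩⟩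

open LieAlgebra.SpecialLinear in
/-- In a finite-dimensional Lie module `M` over `sl(2,ℝ)`, no vector `v` has a
stabilizer subalgebra `{X : X ⬝ v = 0}` of dimension exactly `2`. -/
theorem sl2_stabilizer_dim_ne_two
    {M : Type*} [AddCommGroup M] [Module ℝ M]
    [LieRingModule (sl (Fin 2) ℝ) M] [LieModule ℝ (sl (Fin 2) ℝ) M]
    [FiniteDimensional ℝ M] (v : M)
    (S : Submodule ℝ (sl (Fin 2) ℝ))
    (hS : ∀ X : sl (Fin 2) ℝ, X ∈ S ↔ ⁅X, v⁆ = 0) :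
    Module.finrank ℝ S ≠ 2 := by
  intro h2
  have : FiniteDimensional ℝ (sl (Fin 2) ℝ) := Module.Finite.equiv slEquiv
  have h3 : Module.finrank ℝ (sl (Fin 2) ℝ) = 3 := by
    rw [← slEquiv.finrank_eq]; simp
  have hlt : S < ⊤ := by
    rw [lt_top_iff_ne_top]
    rintro rfl
    rw [finrank_top] at h2
    omega
  obtain ⟨φ, hφ, hle⟩ := Submodule.exists_le_ker_of_lt_top S hlt
  have hk : S = LinearMap.ker φ := by
    apply Submodule.eq_of_le_of_finrank_le hle
    have h4 := Submodule.finrank_lt (s := LinearMap.ker φ)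
      (by rwa [Ne, LinearMap.ker_eq_top])
    omega
  obtain ⟨p, hp⟩ : ∃ p, p = φ (slMk 1 0 0) := ⟨_, rfl⟩
  obtain ⟨q, hq⟩ : ∃ q, q = φ (slMk 0 1 0) := ⟨_, rfl⟩
  obtain ⟨r, hr⟩ : ∃ r, r = φ (slMk 0 0 1) := ⟨_, rfl⟩
  have key : ∀ a b c, φ (slMk a b c) = a * p + b * q + c * r := by
    intro a b c
    have : slMk a b c = a • slMk 1 0 0 + b • slMk 0 1 0 + c • slMk 0 0 1 := by
      simp [slMk_smul, slMk_add]
    rw [this, hp, hq, hr]; simp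
  have mem : ∀ a b c, ⁅slMk a b c, v⁆ = 0 ↔ a * p + b * q + c * r = 0 := by
    intro a b c
    rw [← hS, hk, LinearMap.mem_ker, key]
  have hne : ¬ (p = 0 ∧ q = 0 ∧ r = 0) := by
    rintro ⟨h1, h2, h3⟩
    apply hφ
    ext X
    obtain ⟨a, b, c, rfl⟩ := slMk_surj X
    simp [key, h1, h2, h3]
  have br : ∀ a b c a' b' c', a * p + b * q + c * r = 0 → a' * p + b' * q + c' * r = 0 →
      (b * c' - b' * c) * p + (2 * (a * b' - a' * b)) * q + (2 * (c * a' - c' * a)) * r = 0 := by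
    intro a b c a' b' c' h h'
    rw [← mem] at h h' ⊢
    rw [← slMk_lie, lie_lie, h, h']; simp
  have hD : p ^ 2 + 4 * q * r = 0 := by
    have e1 := br q (-p) 0 r 0 (-p) (by ring) (by ring)
    have e2 := br q (-p) 0 0 r (-q) (by ring) (by ring)
    have e3 := br r 0 (-p) 0 r (-q) (by ring) (by ring)
    by_contra hD
    apply hne
    refine ⟨?_, ?_, ?_⟩
    · exact (mul_eq_zero.1 (show p * (p ^ 2 + 4 * q * r) = 0 by linarith)).resolve_right hD
    · exact (mul_eq_zero.1 (show q * (p ^ 2 + 4 * q * r) = 0 by linarith)).resolve_right hD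
    · exact (mul_eq_zero.1 (show r * (p ^ 2 + 4 * q * r) = 0 by linarith)).resolve_right hD
  have hs : 0 < p ^ 2 + 2 * q ^ 2 + 2 * r ^ 2 := by
    by_contra hs
    apply hne
    refine ⟨?_, ?_, ?_⟩ <;> nlinarith [sq_nonneg p, sq_nonneg q, sq_nonneg r]
  obtain ⟨s, hs'⟩ : ∃ s, s = (2 * (p ^ 2 + 2 * q ^ 2 + 2 * r ^ 2))⁻¹ := ⟨_, rfl⟩
  have hs1 : s * (2 * (p ^ 2 + 2 * q ^ 2 + 2 * r ^ 2)) = 1 := by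
    rw [hs']; exact inv_mul_cancel₀ (by positivity)
  have t : IsSl2Triple (slMk (s * (4 * (r ^ 2 - q ^ 2))) (s * (4 * p * (q - r)))
      (s * (4 * p * (q - r)))) (slMk p (2 * r) (2 * q))
      (slMk (s * p) (s * (2 * q)) (s * (2 * r))) := by
    have e1 : ⁅slMk p (2 * r) (2 * q), slMk (s * p) (s * (2 * q)) (s * (2 * r))⁆ =
      slMk (s * (4 * (r ^ 2 - q ^ 2))) (s * (4 * p * (q - r))) (s * (4 * p * (q - r))) := by
      rw [slMk_lie, slMk_eq_iff]
      refine ⟨by ring, by ring, by ring⟩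
    have e2 : ⁅slMk (s * (4 * (r ^ 2 - q ^ 2))) (s * (4 * p * (q - r)))
      (s * (4 * p * (q - r))), slMk p (2 * r) (2 * q)⁆ = 2 • slMk p (2 * r) (2 * q) := by
      rw [two_smul, slMk_add, slMk_lie, slMk_eq_iff]
      refine ⟨?_, ?_, ?_⟩
      · linear_combination (2 * p) * hs1 - 4 * p * s * hD
      · linear_combination (4 * r) * hs1 - 8 * q * s * hD
      · linear_combination (4 * q) * hs1 - 8 * r * s * hD
    refine ⟨?_, e1, e2, ?_⟩
    · intro h0
      rw [h0, zero_lie, two_smul, slMk_add, ← slMk_zero, slMk_eq_iff] at e2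
      apply hne
      refine ⟨by linarith, by linarith, by linarith⟩
    · rw [two_smul, slMk_add, ← neg_one_smul ℝ, slMk_smul, slMk_lie, slMk_eq_iff]
      refine ⟨?_, ?_, ?_⟩
      · linear_combination (-2 * p * s) * hs1 + 4 * p * s ^ 2 * hD
      · linear_combination (-4 * q * s) * hs1 + 8 * r * s ^ 2 * hD
      · linear_combination (-4 * r * s) * hs1 + 8 * q * s ^ 2 * hD
  have hf : ⁅slMk (s * p) (s * (2 * q)) (s * (2 * r)), v⁆ = 0 := by
    by_cases hv : v = 0
    · simp [hv]
    have P : t.HasPrimitiveVectorWith v (0 : ℝ) :=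
      { ne_zero := hv
        lie_h := by
          rw [zero_smul, mem]; ring
        lie_e := by
          rw [mem]; linear_combination hD }
    simpa using P.pow_toEnd_f_eq_zero_of_eq_nat (n := 0) (by simp)
  rw [mem] at hf
  linarith
end

section
/- Let a : ℝ → ℝ be 1-periodic. For p = (u,t,v) ∈ ℝ³ define the symmetric bilinear form h_a(p) on ℝ³ by h_a(p)(w,w′) = a(v)(w_t w′_t + w_u w′_v + w_v w′_u). For m,n,l ∈ ℤ let g_{m,n,l} : ℝ³ → ℝ³ be the affine map (u,t,v) ↦ (u + m t − (m²/2) v + n/2, t − m v + l/2, v + m), with linear part L_m (the matrix with rows (1, m, −m²/2), (0, 1, −m), (0, 0, 1)). Then for all p, w, w′ ∈ ℝ³: h_a(g_{m,n,l}(p))(L_m w, L_m w′) = h_a(p)(w, w′). -/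
/-- For `a : ℝ → ℝ` `1`-periodic, the affine maps
`g_{m,n,l}(u,t,v) = (u + mt − (m²/2)v + n/2, t − mv + l/2, v + m)` (with `m,n,l ∈ ℤ`)
are isometries of the Lorentz metric `h_a = a(v)(dt² + 2 du dv)` on `ℝ³`, coordinates
`(u,t,v)`: for all `p, w, w'`,
`h_a(g_{m,n,l}(p))(L_m w, L_m w') = h_a(p)(w, w')`, where `L_m` is the linear part. -/
theorem parabolic_isometry_of_ha
    (a : ℝ → ℝ) (ha : ∀ s, a (s + 1) = a s) (m n l : ℤ)
    (L : Matrix (Fin 3) (Fin 3) ℝ)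
    (hL : L = !![1, (m : ℝ), -(m : ℝ) ^ 2 / 2; 0, 1, -(m : ℝ); 0, 0, 1])
    (b : Fin 3 → ℝ) (hb : b = ![(n : ℝ) / 2, (l : ℝ) / 2, (m : ℝ)]) :
    ∀ p w w' : Fin 3 → ℝ,
      a ((L.mulVec p + b) 2) *
        (L.mulVec w 1 * L.mulVec w' 1 + L.mulVec w 0 * L.mulVec w' 2 +
          L.mulVec w 2 * L.mulVec w' 0)
      = a (p 2) * (w 1 * w' 1 + w 0 * w' 2 + w 2 * w' 0) := by
  intro p w w'
  have hp : Function.Periodic a 1 := ha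
  have key : a (p 2 + (m : ℝ)) = a (p 2) := by
    have h := hp.int_mul m (p 2)
    rwa [mul_one] at h
  have e0 : ∀ x : Fin 3 → ℝ, L.mulVec x 0 = x 0 + m * x 1 + (-(m : ℝ) ^ 2 / 2) * x 2 := by
    intro x
    simp [hL, Matrix.mulVec, dotProduct, Fin.sum_univ_three]
  have e1 : ∀ x : Fin 3 → ℝ, L.mulVec x 1 = x 1 + -(m : ℝ) * x 2 := by
    intro x
    simp [hL, Matrix.mulVec, dotProduct, Fin.sum_univ_three]
  have e2 : ∀ x : Fin 3 → ℝ, L.mulVec x 2 = x 2 := by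
    intro x
    simp [hL, Matrix.mulVec, dotProduct, Fin.sum_univ_three]
  have eb : b 2 = (m : ℝ) := by simp [hb]
  rw [Pi.add_apply, e2 p, eb, key]
  simp only [e0, e1, e2]
  ring
end

section
/- Let v ∈ ℝ⁵ with v ≠ 0 and Q(v) = 0. Then the projective point ℝ·v is fixed by every element of the group N—that is, for all x,y,z ∈ ℝ there exists c ∈ ℝ with N(x,y,z)·v = c·v—if and only if v ∈ span(e₀, e₁), the span of the first two standard basis vectors of ℝ⁵. -/
/-- The standard Heisenberg matrices `N(x,y,z)` in `O(2,3)`. -/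
noncomputable def Nmat (x y z : ℝ) : Matrix (Fin 5) (Fin 5) ℝ :=
  !![1, 0, -x, -(z + x * y), -x ^ 2 / 2;
     0, 1, -y, -y ^ 2 / 2, z;
     0, 0, 1, y, x;
     0, 0, 0, 1, 0;
     0, 0, 0, 0, 1]

/-- A nonzero isotropic vector `v` of `Q(x) = 2x₀x₄ + 2x₁x₃ + x₂²` spans a projective
point fixed by every element of the Heisenberg group `N` if and only if `v` lies in the
span of the first two standard basis vectors of `ℝ⁵`. -/
theorem fixed_points_of_heisenberg_are_photon
    (v : Fin 5 → ℝ) (hv : v ≠ 0)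
    (hQ : 2 * v 0 * v 4 + 2 * v 1 * v 3 + (v 2) ^ 2 = 0) :
    (∀ x y z : ℝ, ∃ c : ℝ, (Nmat x y z).mulVec v = c • v) ↔
      v ∈ Submodule.span ℝ ({![1, 0, 0, 0, 0], ![0, 1, 0, 0, 0]} : Set (Fin 5 → ℝ)) := by
  rw [Submodule.mem_span_pair]
  constructor
  · intro h
    have key : ∀ x y : ℝ, ∃ c : ℝ, v 2 + y * v 3 + x * v 4 = c * v 2 ∧ v 3 = c * v 3 ∧
        v 4 = c * v 4 := by
      intro x y
      obtain ⟨c, hc⟩ := h x y 0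
      have h2 := congrFun hc 2
      have h3 := congrFun hc 3
      have h4 := congrFun hc 4
      simp only [Nmat, Matrix.mulVec, dotProduct, Fin.sum_univ_five, Pi.smul_apply,
        smul_eq_mul, Matrix.of_apply, Matrix.cons_val] at h2 h3 h4
      exact ⟨c, by linarith, by linarith, by linarith⟩
    have a3 : v 3 = 0 := by
      by_contra hne
      obtain ⟨c, h2, h3, -⟩ := key 0 1
      have hc : c = 1 := mul_right_cancel₀ hne (by linarith)
      subst hc
      exact hne (by linarith)
    have a4 : v 4 = 0 := by
      by_contra hne
      obtain ⟨c, h2, -, h4⟩ := key 1 0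
      have hc : c = 1 := mul_right_cancel₀ hne (by linarith)
      subst hc
      exact hne (by linarith)
    have a2 : v 2 = 0 := by
      rw [a3, a4] at hQ
      exact pow_eq_zero_iff (two_ne_zero) |>.1 (by linarith)
    refine ⟨v 0, v 1, ?_⟩
    ext i
    fin_cases i <;> simp [a2, a3, a4]
  · rintro ⟨a, b, rfl⟩ x y z
    refine ⟨1, ?_⟩
    ext i
    fin_cases i <;> simp [Nmat, Matrix.mulVec, dotProduct, Fin.sum_univ_five]
end

section
/- Let V be a finite-dimensional real vector space and B a nondegenerate symmetric bilinear form on V. Let v ∈ V with v ≠ 0 and B(v,v) = 0, and let H = {x ∈ V : B(v,x) = 0} be its orthogonal hyperplane. If g : V → V is a linear map with B(gx, gy) = B(x,y) for all x,y ∈ V and g(x) = x for every x ∈ H, then g is the identity of V. -/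
/-- Let `B` be a nondegenerate symmetric bilinear form on a finite-dimensional real
vector space `V`, and `v ≠ 0` isotropic.  A linear map preserving `B` which fixes the
orthogonal hyperplane `{x : B(v,x) = 0}` pointwise is the identity. -/
theorem isometry_fixing_lightlike_hyperplane_is_id
    {V : Type*} [AddCommGroup V] [Module ℝ V] [FiniteDimensional ℝ V]
    (B : LinearMap.BilinForm ℝ V) (hB : B.Nondegenerate)
    (hsymm : ∀ x y, B x y = B y x)
    (v : V) (hv : v ≠ 0) (hvv : B v v = 0)
    (g : V →ₗ[ℝ] V) (hg : ∀ x y, B (g x) (g y) = B x y)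
    (hfix : ∀ x, B v x = 0 → g x = x) :
    g = LinearMap.id := by
  have nd : ∀ x, (∀ y, B x y = 0) → x = 0 := fun x h => hB.1 x h
  obtain ⟨w, hw⟩ : ∃ w, B v w ≠ 0 := by
    by_contra! h
    exact hv (nd v h)
  have dec : ∀ y, B v (y - (B v y / B v w) • w) = 0 := by
    intro y
    simp only [map_sub, map_smul, smul_eq_mul]
    field_simp
    ring
  have dH : ∀ h, B v h = 0 → B (g w - w) h = 0 := by
    intro h hh
    have h1 := hg w h
    rw [hfix h hh] at h1
    simp [h1]
  have hd : g (g w - w) = g w - w := hfix _ (by rw [hsymm]; exact dH v hvv)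
  have dd : B (g w - w) (g w - w) = 0 := dH _ (by rw [hsymm]; exact dH v hvv)
  have dw : B (g w - w) w = 0 := by
    have h1 := hg w w
    have h2 := hsymm (g w) w
    simp only [map_sub, LinearMap.sub_apply] at dd ⊢
    linarith
  have d0 : g w - w = 0 := by
    apply nd
    intro y
    have h1 := dH _ (dec y)
    rw [map_sub, map_smul, dw] at h1
    simpa using h1
  have gw : g w = w := sub_eq_zero.mp d0
  ext y
  have h1 := hfix _ (dec y)
  rw [map_sub, map_smul, gw] at h1
  simpa using h1
end
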